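/- There exist absolute constants C, c > 0 such that for any 2 ≤ N ≤ t and any ε > 0, with probability at least 1 − C e^{C d − c n/t²} − C/(ε² n) − C (1 + C N²/ε)^d e^{−c min(n ε², n ε/t²)} over the draw of x_1, …, x_n, one has sup_{u ∈ S^{d−1}} (1/n) Σ_{i=1}^n (u^⊤ x_i)² 1_{|u^⊤ x_i| ≥ N} (w*^⊤ x_i)² 1_{|w*^⊤ x_i| ≤ t} ≤ C ε + C N³ e^{−N²/16}. -/

import Mathlib

open MeasureTheory ProbabilityTheory Real

noncomputable section

/-- Euclidean inner product on `Fin d → ℝ`. -/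
def dot {d : ℕ} (u v : Fin d → ℝ) : ℝ := ∑ j, u j * v j

/-- Euclidean norm on `Fin d → ℝ`. -/
def nrm {d : ℕ} (u : Fin d → ℝ) : ℝ := Real.sqrt (∑ j, (u j) ^ 2)

/-- Standard Gaussian `N(0, I_d)` on `Fin d → ℝ`. -/
def stdGaussian (d : ℕ) : Measure (Fin d → ℝ) := Measure.pi fun _ => gaussianReal 0 1

/-- Law of `n` i.i.d. draws from `N(0, I_d)`. -/
def sample (n d : ℕ) : Measure (Fin n → Fin d → ℝ) := Measure.pi fun _ => stdGaussian d

/-- Real-valued indicator of a decidable proposition. -/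
def ind (p : Prop) [Decidable p] : ℝ := if p then 1 else 0

/-! ### Nets -/

theorem card_sep {E : Type*} [NormedAddCommGroup E] [NormedSpace ℝ E] [FiniteDimensional ℝ E]
    (η : ℝ) (hη : 0 < η) (s : Finset E) (hs : ∀ c ∈ s, ‖c‖ ≤ 1)
    (h : ∀ c ∈ s, ∀ d ∈ s, c ≠ d → η ≤ ‖c - d‖) :
    (s.card : ℝ) ≤ (1 + 2 / η) ^ Module.finrank ℝ E := by
  borelize E
  let μ : Measure E := Measure.addHaar
  let δ : ℝ := η / 2
  let ρ : ℝ := 1 + η / 2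
  have ρpos : 0 < ρ := by positivity
  have δpos : 0 < δ := by positivity
  set A := ⋃ c ∈ s, Metric.ball (c : E) δ with hA
  have D : Set.Pairwise (s : Set E) (Function.onFun Disjoint fun c => Metric.ball (c : E) δ) := by
    rintro c hc d hd hcd
    apply Metric.ball_disjoint_ball
    rw [dist_eq_norm]
    have := h c hc d hd hcd
    simp only [δ]; linarith
  have A_subset : A ⊆ Metric.ball (0 : E) ρ := by
    refine Set.iUnion₂_subset fun x hx => ?_
    apply Metric.ball_subset_ball'
    have := hs x hx
    rw [dist_zero_right]
    simp only [δ, ρ]; linarith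
  have I : (s.card : ENNReal) * ENNReal.ofReal (δ ^ Module.finrank ℝ E) * μ (Metric.ball 0 1) ≤
      ENNReal.ofReal (ρ ^ Module.finrank ℝ E) * μ (Metric.ball 0 1) :=
    calc
      (s.card : ENNReal) * ENNReal.ofReal (δ ^ Module.finrank ℝ E) * μ (Metric.ball 0 1) = μ A := by
        rw [hA, measure_biUnion_finset D fun c _ => measurableSet_ball]
        simp only [μ.addHaar_ball_of_pos _ δpos]
        simp only [Finset.sum_const, nsmul_eq_mul, mul_assoc]
      _ ≤ μ (Metric.ball (0 : E) ρ) := measure_mono A_subset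
      _ = ENNReal.ofReal (ρ ^ Module.finrank ℝ E) * μ (Metric.ball 0 1) := by
        simp only [μ.addHaar_ball_of_pos _ ρpos]
  have J : (s.card : ENNReal) * ENNReal.ofReal (δ ^ Module.finrank ℝ E)
      ≤ ENNReal.ofReal (ρ ^ Module.finrank ℝ E) :=
    (ENNReal.mul_le_mul_iff_left (Metric.measure_ball_pos _ _ zero_lt_one).ne'
      measure_ball_lt_top.ne).1 I
  have K := ENNReal.toReal_le_of_le_ofReal (pow_nonneg ρpos.le _) J
  rw [ENNReal.toReal_mul, ENNReal.toReal_ofReal (by positivity), ENNReal.toReal_natCast] at K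
  have e : (1 + 2 / η) = ρ / δ := by simp only [ρ, δ]; field_simp; ring
  rw [e, div_pow, le_div_iff₀ (by positivity)]
  exact K

theorem exists_net {d : ℕ} (η : ℝ) (hη : 0 < η) :
    ∃ s : Finset (Fin d → ℝ), (∀ v ∈ s, nrm v = 1) ∧ (s.card : ℝ) ≤ (1 + 2 / η) ^ d ∧
      ∀ u : Fin d → ℝ, nrm u = 1 → ∃ v ∈ s, nrm (u - v) ≤ η := by
  classical
  have hn : ∀ u : Fin d → ℝ, nrm u = ‖WithLp.toLp 2 u‖ := by
    intro u; simp [nrm, EuclideanSpace.norm_eq]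
  let P : Finset (Fin d → ℝ) → Prop := fun s => (∀ v ∈ s, nrm v = 1) ∧
    ∀ v ∈ s, ∀ v' ∈ s, v ≠ v' → η ≤ nrm (v - v')
  have hcard : ∀ s, P s → (s.card : ℝ) ≤ (1 + 2 / η) ^ d := by
    intro s hs
    have := card_sep η hη (s.image (WithLp.toLp 2 : (Fin d → ℝ) → EuclideanSpace ℝ (Fin d)))
      (by
        intro c hc
        obtain ⟨v, hv, rfl⟩ := Finset.mem_image.1 hc
        rw [← hn, hs.1 v hv])
      (by
        intro c hc c' hc' hne
        obtain ⟨v, hv, rfl⟩ := Finset.mem_image.1 hc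
        obtain ⟨v', hv', rfl⟩ := Finset.mem_image.1 hc'
        rw [← WithLp.toLp_sub, ← hn]
        exact hs.2 v hv v' hv' (fun h => hne (by rw [h])))
    rw [Finset.card_image_of_injective _ (WithLp.toLp_injective 2)] at this
    simpa using this
  let Q : ℕ → Prop := fun k => ∃ s, P s ∧ s.card = k
  have hQ0 : Q 0 := ⟨∅, ⟨by simp, by simp⟩, rfl⟩
  let B := ⌊(1 + 2 / η) ^ d⌋₊
  have hQB : ∀ k, Q k → k ≤ B := by
    rintro k ⟨s, hs, rfl⟩
    exact Nat.le_floor (hcard s hs)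
  obtain ⟨s, hs, hsc⟩ : Q (Nat.findGreatest Q B) := Nat.findGreatest_spec (Nat.zero_le _) hQ0
  refine ⟨s, hs.1, hcard s hs, ?_⟩
  intro u hu
  by_contra! hcon
  have hus : u ∉ s := fun h => by
    have := hcon u h
    simp [nrm] at this
    linarith
  have hsymm : ∀ a b : Fin d → ℝ, nrm (a - b) = nrm (b - a) := by
    intro a b; rw [hn, hn, WithLp.toLp_sub, WithLp.toLp_sub, norm_sub_rev]
  have : Q (s.card + 1) := by
    refine ⟨insert u s, ⟨?_, ?_⟩, Finset.card_insert_of_notMem hus⟩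
    · intro v hv
      rcases Finset.mem_insert.1 hv with rfl | hv
      · exact hu
      · exact hs.1 v hv
    · intro v hv v' hv' hne
      rcases Finset.mem_insert.1 hv with rfl | hv1
      · rcases Finset.mem_insert.1 hv' with rfl | hv'
        · exact absurd rfl hne
        · exact (hcon _ hv').le
      · rcases Finset.mem_insert.1 hv' with rfl | hv'
        · rw [hsymm]; exact (hcon _ hv1).le
        · exact hs.2 v hv1 v' hv' hne
  have h2 := Nat.le_findGreatest (hQB _ this) this
  omega

/-! ### Gaussian facts -/

theorem dot_measurable {d : ℕ} (u : Fin d → ℝ) : Measurable (dot u) := by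
  unfold dot; fun_prop

theorem map_dot {d : ℕ} (u : Fin d → ℝ) (hu : nrm u = 1) :
    (_root_.stdGaussian d).map (dot u) = gaussianReal 0 1 := by
  have hn : ‖WithLp.toLp 2 u‖ = 1 := by rw [← hu]; simp [nrm, EuclideanSpace.norm_eq]
  let L : StrongDual ℝ (EuclideanSpace ℝ (Fin d)) := innerSL ℝ (WithLp.toLp 2 u)
  have hL : ‖L‖ = 1 := by simp only [L, innerSL_apply_norm]; exact hn
  have hd : dot u = L ∘ (WithLp.toLp 2) := by
    ext x
    simp [L, dot, PiLp.inner_apply, mul_comm]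
  rw [hd, ← Measure.map_map (by fun_prop) (by fun_prop), _root_.stdGaussian,
    map_pi_eq_stdGaussian, IsGaussian.map_eq_gaussianReal L, variance_dual_stdGaussian, hL,
    integral_strongDual_stdGaussian]
  simp

def GG : ℝ := ∫ x, Real.exp (3 / 8 * x ^ 2) ∂(gaussianReal 0 1)

theorem GG_integrable : Integrable (fun x : ℝ => Real.exp (3 / 8 * x ^ 2)) (gaussianReal 0 1) := by
  rw [gaussianReal_of_var_ne_zero _ one_ne_zero]
  rw [integrable_withDensity_iff_integrable_smul' (by fun_prop)
    (ae_of_all _ fun _ ↦ gaussianPDF_lt_top)]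
  have := (integrable_exp_neg_mul_sq (b := 1 / 8) (by norm_num)).const_mul (√(2 * π))⁻¹
  refine this.congr (ae_of_all _ fun x => ?_)
  simp only [toReal_gaussianPDF, gaussianPDFReal, smul_eq_mul]
  rw [mul_assoc, ← Real.exp_add]
  simp
  ring_nf
  simp

theorem GG_ge : 1 ≤ GG := by
  have : ∫ x : ℝ, (1 : ℝ) ∂(gaussianReal 0 1) ≤ GG :=
    integral_mono (by simp) GG_integrable (fun x => Real.one_le_exp (by positivity))
  simpa using this

theorem lint_dot {d : ℕ} (u : Fin d → ℝ) (hu : nrm u = 1) :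
    ∫⁻ x, ENNReal.ofReal (Real.exp (3 / 8 * (dot u x) ^ 2)) ∂(_root_.stdGaussian d)
      = ENNReal.ofReal GG := by
  rw [← lintegral_map (f := fun y : ℝ => ENNReal.ofReal (Real.exp (3 / 8 * y ^ 2)))
    (by fun_prop) (dot_measurable u), map_dot u hu, GG,
    ofReal_integral_eq_lintegral_ofReal GG_integrable (ae_of_all _ fun x => (Real.exp_pos _).le)]

/-! ### The truncated quantity -/

def zz {d : ℕ} (w : Fin d → ℝ) (t : ℝ) (x : Fin d → ℝ) : ℝ :=
  (dot w x) ^ 2 * ind (|dot w x| ≤ t)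

def YY {d : ℕ} (w : Fin d → ℝ) (t M : ℝ) (u x : Fin d → ℝ) : ℝ :=
  zz w t x * (max (|dot u x| - M) 0) ^ 2

theorem zz_nonneg {d : ℕ} (w : Fin d → ℝ) (t : ℝ) (x : Fin d → ℝ) : 0 ≤ zz w t x := by
  unfold zz ind; split_ifs <;> simp; positivity

theorem zz_le {d : ℕ} (w : Fin d → ℝ) (t : ℝ) (x : Fin d → ℝ) : zz w t x ≤ (dot w x) ^ 2 := by
  unfold zz ind; split_ifs <;> simp; positivity

theorem zz_le_t {d : ℕ} (w : Fin d → ℝ) (t : ℝ) (x : Fin d → ℝ) : zz w t x ≤ t ^ 2 := by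
  unfold zz ind; split_ifs with h
  · rw [mul_one, ← sq_abs]; gcongr
  · simp; positivity

theorem YY_nonneg {d : ℕ} (w : Fin d → ℝ) (t M : ℝ) (u x : Fin d → ℝ) : 0 ≤ YY w t M u x :=
  mul_nonneg (zz_nonneg _ _ _) (sq_nonneg _)

theorem zz_measurable {d : ℕ} (w : Fin d → ℝ) (t : ℝ) : Measurable (zz w t) := by
  unfold zz ind
  have h := dot_measurable w
  refine Measurable.mul (by fun_prop) (Measurable.ite ?_ (by fun_prop) (by fun_prop))
  exact measurableSet_le (by fun_prop) (by fun_prop)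

theorem YY_measurable {d : ℕ} (w : Fin d → ℝ) (t M : ℝ) (u : Fin d → ℝ) :
    Measurable (YY w t M u) := by
  have h := dot_measurable u
  have h2 := zz_measurable w t
  unfold YY
  fun_prop

theorem le_exp16 (x : ℝ) : x ≤ 16 * Real.exp (x / 16) := by
  have := Real.add_one_le_exp (x / 16)
  linarith

theorem exp_add_le (a b : ℝ) : Real.exp (a + b) ≤ Real.exp (2 * a) + Real.exp (2 * b) := by
  have h1 : Real.exp (2 * a) = Real.exp a ^ 2 := by rw [← Real.exp_nat_mul]; norm_cast
  have h2 : Real.exp (2 * b) = Real.exp b ^ 2 := by rw [← Real.exp_nat_mul]; norm_cast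
  rw [Real.exp_add, h1, h2]
  nlinarith [sq_nonneg (Real.exp a - Real.exp b), sq_nonneg (Real.exp a), sq_nonneg (Real.exp b)]

theorem exp_quad (z : ℝ) (hz : 0 ≤ z) : Real.exp z ≤ 1 + z + z ^ 2 * Real.exp z := by
  have h1 := Real.add_one_le_exp (-z)
  have h2 : Real.exp (-z) * Real.exp z = 1 := by rw [← Real.exp_add]; simp
  have h3 := Real.exp_pos z
  have h4 : (1 - z) * Real.exp z ≤ 1 := by nlinarith
  nlinarith [mul_le_mul_of_nonneg_left h4 (by linarith : (0 : ℝ) ≤ 1 + z)]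

/-- mean-type pointwise bound -/
theorem YY_le {d : ℕ} (w : Fin d → ℝ) (t M : ℝ) (hM : 0 ≤ M) (u x : Fin d → ℝ) :
    YY w t M u x ≤ 65536 * Real.exp (-M ^ 2 / 9) *
      (Real.exp (3 / 8 * (dot w x) ^ 2) + Real.exp (3 / 8 * (dot u x) ^ 2)) := by
  unfold YY
  rcases le_or_gt (|dot u x|) M with h | h
  · rw [max_eq_right (by linarith)]
    simp; positivity
  · rw [max_eq_left (by linarith)]
    have hs : M ^ 2 ≤ (dot u x) ^ 2 := by rw [← sq_abs (dot u x)]; gcongr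
    have hs2 : (|dot u x| - M) ^ 2 ≤ (dot u x) ^ 2 := by
      rw [← sq_abs (dot u x)]; gcongr
      linarith
    have hz := zz_le w t x
    have hz0 := zz_nonneg w t x
    set a := (dot w x) ^ 2
    set y := (dot u x) ^ 2
    have ha : 0 ≤ a := sq_nonneg _
    have hy : 0 ≤ y := sq_nonneg _
    calc zz w t x * (|dot u x| - M) ^ 2 ≤ a * y := by gcongr
      _ ≤ (16 * Real.exp (a / 16)) * (16 * Real.exp (y / 16)) := by
          gcongr <;> exact le_exp16 _
      _ ≤ (16 * Real.exp (a / 16)) * (16 * Real.exp (y / 16)) * Real.exp (-M ^ 2 / 9 + y / 9) := by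
          apply le_mul_of_one_le_right (by positivity)
          apply Real.one_le_exp; linarith
      _ = 256 * Real.exp (-M ^ 2 / 9) * Real.exp (a / 16 + (y / 16 + y / 9)) := by
          simp only [Real.exp_add]; ring
      _ ≤ 65536 * Real.exp (-M ^ 2 / 9) * (Real.exp (2 * (a / 16)) +
            Real.exp (2 * (y / 16 + y / 9))) := by
          gcongr
          · norm_num
          · exact exp_add_le _ _
      _ ≤ _ := by
          gcongr _ * (Real.exp ?_ + Real.exp ?_) <;> linarith

theorem YY_sq_exp_le {d : ℕ} (w : Fin d → ℝ) (t M l : ℝ) (hM : 0 ≤ M) (hl : 0 ≤ l)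
    (hlt : l * t ^ 2 ≤ 1 / 16) (u x : Fin d → ℝ) :
    YY w t M u x ^ 2 * Real.exp (l * YY w t M u x) ≤ 65536 *
      (Real.exp (3 / 8 * (dot w x) ^ 2) + Real.exp (3 / 8 * (dot u x) ^ 2)) := by
  have hm : (max (|dot u x| - M) 0) ^ 2 ≤ (dot u x) ^ 2 := by
    rw [← sq_abs (dot u x)]; gcongr
    apply max_le
    · linarith
    · positivity
  have hz := zz_le w t x
  have hzt := zz_le_t w t x
  have hz0 := zz_nonneg w t x
  have hY0 := YY_nonneg w t M u x
  have hY1 : YY w t M u x ≤ (dot w x) ^ 2 * (dot u x) ^ 2 := by unfold YY; gcongr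
  have hY2 : l * YY w t M u x ≤ (dot u x) ^ 2 / 16 := by
    calc l * YY w t M u x ≤ l * (t ^ 2 * (dot u x) ^ 2) := by unfold YY; gcongr
      _ = (l * t ^ 2) * (dot u x) ^ 2 := by ring
      _ ≤ 1 / 16 * (dot u x) ^ 2 := by gcongr
      _ = _ := by ring
  set a := (dot w x) ^ 2
  set y := (dot u x) ^ 2
  have ha : 0 ≤ a := sq_nonneg _
  have hy : 0 ≤ y := sq_nonneg _
  calc YY w t M u x ^ 2 * Real.exp (l * YY w t M u x) ≤ (a * y) ^ 2 * Real.exp (y / 16) := by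
        gcongr
    _ ≤ ((16 * Real.exp (a / 16)) * (16 * Real.exp (y / 16))) ^ 2 * Real.exp (y / 16) := by
          gcongr <;> exact le_exp16 _
    _ = 65536 * Real.exp (a / 16 + a / 16 + (y / 16 + y / 16 + y / 16)) := by
          simp only [Real.exp_add]; ring
    _ ≤ 65536 * (Real.exp (2 * (a / 16 + a / 16)) +
            Real.exp (2 * (y / 16 + y / 16 + y / 16))) := by
          gcongr
          exact exp_add_le _ _
    _ ≤ _ := by
          gcongr _ * (Real.exp ?_ + Real.exp ?_) <;> linarith

def KK : ℝ := 65536 * (2 * GG)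

theorem KK_ge : 1 ≤ KK := by unfold KK; linarith [GG_ge]

instance (d : ℕ) : IsProbabilityMeasure (_root_.stdGaussian d) := by
  unfold _root_.stdGaussian; infer_instance

instance (n d : ℕ) : IsProbabilityMeasure (sample n d) := by
  unfold sample; infer_instance

theorem mgf_YY {d : ℕ} (w : Fin d → ℝ) (t M l : ℝ) (hM : 0 ≤ M) (hl : 0 ≤ l)
    (hlt : l * t ^ 2 ≤ 1 / 16) (u : Fin d → ℝ) (hw : nrm w = 1) (hu : nrm u = 1) :
    ∫⁻ x, ENNReal.ofReal (Real.exp (l * YY w t M u x)) ∂(_root_.stdGaussian d) ≤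
      ENNReal.ofReal (Real.exp (l * (KK * Real.exp (-M ^ 2 / 9)) + l ^ 2 * KK)) := by
  set A : ℝ := (l * Real.exp (-M ^ 2 / 9) + l ^ 2) * 65536 with hA
  have hA0 : 0 ≤ A := by positivity
  have hpt : ∀ x, ENNReal.ofReal (Real.exp (l * YY w t M u x)) ≤
      1 + ENNReal.ofReal A * (ENNReal.ofReal (Real.exp (3 / 8 * (dot w x) ^ 2)) +
        ENNReal.ofReal (Real.exp (3 / 8 * (dot u x) ^ 2))) := by
    intro x
    rw [← ENNReal.ofReal_add (by positivity) (by positivity), ← ENNReal.ofReal_mul hA0,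
      ← ENNReal.ofReal_one, ← ENNReal.ofReal_add (by positivity) (by positivity)]
    apply ENNReal.ofReal_le_ofReal
    have h1 := exp_quad (l * YY w t M u x) (mul_nonneg hl (YY_nonneg _ _ _ _ _))
    have h2 := mul_le_mul_of_nonneg_left (YY_le w t M hM u x) hl
    have h3 := mul_le_mul_of_nonneg_left (YY_sq_exp_le w t M l hM hl hlt u x) (sq_nonneg l)
    rw [hA]
    nlinarith
  have hmw : Measurable fun x => ENNReal.ofReal (Real.exp (3 / 8 * (dot w x) ^ 2)) := by
    have := dot_measurable w; fun_prop
  have hmu : Measurable fun x => ENNReal.ofReal (Real.exp (3 / 8 * (dot u x) ^ 2)) := by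
    have := dot_measurable u; fun_prop
  refine (lintegral_mono hpt).trans ?_
  rw [lintegral_add_left measurable_const, lintegral_const_mul _ (by fun_prop),
    lintegral_add_left hmw, lint_dot w hw, lint_dot u hu]
  have hG := GG_ge
  rw [← ENNReal.ofReal_add (by linarith) (by linarith), ← ENNReal.ofReal_mul hA0]
  simp only [lintegral_const, measure_univ, mul_one]
  rw [← ENNReal.ofReal_one, ← ENNReal.ofReal_add (by positivity) (by positivity)]
  apply ENNReal.ofReal_le_ofReal
  have := Real.add_one_le_exp (l * (KK * Real.exp (-M ^ 2 / 9)) + l ^ 2 * KK)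
  refine le_trans (le_of_eq ?_) this
  rw [hA, KK]; ring

theorem mgf_sum {n d : ℕ} (w : Fin d → ℝ) (t M l : ℝ) (hM : 0 ≤ M) (hl : 0 ≤ l)
    (hlt : l * t ^ 2 ≤ 1 / 16) (u : Fin d → ℝ) (hw : nrm w = 1) (hu : nrm u = 1) :
    ∫⁻ x, ENNReal.ofReal (Real.exp (l * ∑ i, YY w t M u (x i))) ∂(sample n d) ≤
      ENNReal.ofReal (Real.exp (n * (l * (KK * Real.exp (-M ^ 2 / 9)) + l ^ 2 * KK))) := by
  have hYm := YY_measurable w t M u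
  have hm : Measurable fun x => ENNReal.ofReal (Real.exp (l * YY w t M u x)) := by fun_prop
  have hind : iIndepFun (fun (i : Fin n) (x : Fin n → Fin d → ℝ) =>
      ENNReal.ofReal (Real.exp (l * YY w t M u (x i)))) (sample n d) :=
    iIndepFun_pi (μ := fun _ : Fin n => _root_.stdGaussian d)
      (X := fun _ x => ENNReal.ofReal (Real.exp (l * YY w t M u x)))
      (fun i => hm.aemeasurable)
  have h1 := lintegral_prod_eq_prod_lintegral_of_indepFun Finset.univ _ hind
    (fun i => hm.comp (measurable_pi_apply i))
  have h2 : ∀ i : Fin n, ∫⁻ x, ENNReal.ofReal (Real.exp (l * YY w t M u (x i))) ∂(sample n d)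
      = ∫⁻ x, ENNReal.ofReal (Real.exp (l * YY w t M u x)) ∂(_root_.stdGaussian d) := by
    intro i
    have := (measurePreserving_eval (fun _ : Fin n => _root_.stdGaussian d) i)
    exact this.lintegral_comp hm
  calc _ = ∫⁻ x, ∏ i, ENNReal.ofReal (Real.exp (l * YY w t M u (x i))) ∂(sample n d) := by
        congr 1; ext x
        rw [Finset.mul_sum, Real.exp_sum, ENNReal.ofReal_prod_of_nonneg]
        intro i _; positivity
    _ = _ := h1
    _ ≤ ∏ i : Fin n, ENNReal.ofReal (Real.exp (l * (KK * Real.exp (-M ^ 2 / 9)) + l ^ 2 * KK)) := by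
        gcongr with i
        rw [h2 i]
        exact mgf_YY w t M l hM hl hlt u hw hu
    _ = _ := by
        rw [Finset.prod_const, Finset.card_univ, Fintype.card_fin,
          ← ENNReal.ofReal_pow (by positivity), ← Real.exp_nat_mul]

theorem tail_YY {n d : ℕ} (w : Fin d → ℝ) (t M e : ℝ) (hM : 0 ≤ M) (ht : 0 < t) (he : 0 < e)
    (u : Fin d → ℝ) (hw : nrm w = 1) (hu : nrm u = 1) :
    sample n d {x | n * (KK * Real.exp (-M ^ 2 / 9) + 2 * KK * e) ≤ ∑ i, YY w t M u (x i)} ≤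
      ENNReal.ofReal (Real.exp (-(1 / 16) * min (n * e ^ 2) (n * e / t ^ 2))) := by
  set l := min e (1 / (16 * t ^ 2)) with hl
  have hl0 : 0 < l := by rw [hl]; apply lt_min he; positivity
  have hle : l ≤ e := min_le_left _ _
  have hlt : l * t ^ 2 ≤ 1 / 16 := by
    calc l * t ^ 2 ≤ 1 / (16 * t ^ 2) * t ^ 2 := by gcongr; exact min_le_right _ _
      _ = 1 / 16 := by field_simp
  have hK := KK_ge
  set m := KK * Real.exp (-M ^ 2 / 9) with hm
  have hYm := YY_measurable w t M u
  have hsm : Measurable fun x : Fin n → Fin d → ℝ =>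
      ENNReal.ofReal (Real.exp (l * ∑ i, YY w t M u (x i))) := by fun_prop
  have h1 := mul_meas_ge_le_lintegral (μ := sample n d) hsm
    (ENNReal.ofReal (Real.exp (l * (n * (m + 2 * KK * e)))))
  have h2 := h1.trans (mgf_sum w t M l hM hl0.le hlt u hw hu)
  have hsub : {x : Fin n → Fin d → ℝ | n * (m + 2 * KK * e) ≤ ∑ i, YY w t M u (x i)} ⊆
      {x | ENNReal.ofReal (Real.exp (l * (n * (m + 2 * KK * e)))) ≤
        ENNReal.ofReal (Real.exp (l * ∑ i, YY w t M u (x i)))} := by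
    intro x hx
    simp only [Set.mem_ofPred_eq] at hx ⊢
    gcongr
  have h3 : ENNReal.ofReal (Real.exp (l * (n * (m + 2 * KK * e)))) *
      sample n d {x | n * (m + 2 * KK * e) ≤ ∑ i, YY w t M u (x i)} ≤
      ENNReal.ofReal (Real.exp (n * (l * m + l ^ 2 * KK))) :=
    (by gcongr : _ ≤ _).trans h2
  have h4 : sample n d {x | n * (m + 2 * KK * e) ≤ ∑ i, YY w t M u (x i)} ≤
      ENNReal.ofReal (Real.exp (n * (l * m + l ^ 2 * KK) - l * (n * (m + 2 * KK * e)))) := by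
    rw [Real.exp_sub, ENNReal.ofReal_div_of_pos (Real.exp_pos _),
      ENNReal.le_div_iff_mul_le (Or.inl (by simp [Real.exp_pos])) (Or.inl (by simp)), mul_comm]
    exact h3
  refine h4.trans ?_
  apply ENNReal.ofReal_le_ofReal
  apply Real.exp_le_exp.2
  have h5 : 1 / 16 * min (n * e ^ 2) (n * e / t ^ 2) ≤ n * (l * e) := by
    rcases min_choice e (1 / (16 * t ^ 2)) with h | h
    · rw [hl, h]
      have := min_le_left ((n : ℝ) * e ^ 2) (n * e / t ^ 2)
      have h0 : 0 ≤ (n : ℝ) * e ^ 2 := by positivity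
      nlinarith
    · rw [hl, h]
      have := min_le_right ((n : ℝ) * e ^ 2) (n * e / t ^ 2)
      have h0 : (n : ℝ) * (1 / (16 * t ^ 2) * e) = 1 / 16 * (n * e / t ^ 2) := by field_simp
      linarith
  have h6 : (n : ℝ) * (l * e) ≤ KK * (n * (l * e)) := le_mul_of_one_le_left (by positivity) hK
  have h7 : (n : ℝ) * KK * l * l ≤ n * KK * l * e := by gcongr
  nlinarith

/-! ### Deterministic part -/

theorem dot_sub {d : ℕ} (u v x : Fin d → ℝ) : dot (u - v) x = dot u x - dot v x := by
  simp [dot, sub_mul, Finset.sum_sub_distrib]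

theorem dot_smul {d : ℕ} (c : ℝ) (u x : Fin d → ℝ) : dot (c • u) x = c * dot u x := by
  simp [dot, Finset.mul_sum, mul_assoc]

theorem nrm_smul {d : ℕ} (c : ℝ) (hc : 0 ≤ c) (u : Fin d → ℝ) : nrm (c • u) = c * nrm u := by
  simp only [nrm, Pi.smul_apply, smul_eq_mul, mul_pow, ← Finset.mul_sum]
  rw [Real.sqrt_mul (sq_nonneg c), Real.sqrt_sq hc]

theorem YY_zero {d : ℕ} (w : Fin d → ℝ) (t : ℝ) (u x : Fin d → ℝ) :
    YY w t 0 u x = zz w t x * (dot u x) ^ 2 := by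
  simp [YY]

theorem YY_par {d : ℕ} (w : Fin d → ℝ) (t M : ℝ) (u v x : Fin d → ℝ) :
    YY w t M u x ≤ 2 * YY w t M v x + 2 * YY w t 0 (u - v) x := by
  rw [YY_zero]
  unfold YY
  have hz := zz_nonneg w t x
  have h : (max (|dot u x| - M) 0) ^ 2 ≤ 2 * (max (|dot v x| - M) 0) ^ 2
      + 2 * (dot (u - v) x) ^ 2 := by
    rw [dot_sub, ← sq_abs (dot u x - dot v x)]
    have h1 : max (|dot u x| - M) 0 ≤ max (|dot v x| - M) 0 + |dot u x - dot v x| := by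
      have h2 := abs_sub_abs_le_abs_sub (dot u x) (dot v x)
      apply max_le
      · linarith [le_max_left (|dot v x| - M) 0]
      · linarith [le_max_right (|dot v x| - M) 0, abs_nonneg (dot u x - dot v x)]
    have h3 : 0 ≤ max (|dot u x| - M) 0 := le_max_right _ _
    nlinarith [sq_nonneg (max (|dot v x| - M) 0 - |dot u x - dot v x|),
      mul_self_le_mul_self h3 h1]
  nlinarith [mul_le_mul_of_nonneg_left h hz]

theorem term_le {d : ℕ} (w : Fin d → ℝ) (t N : ℝ) (hN : 0 ≤ N) (u x : Fin d → ℝ) :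
    (dot u x) ^ 2 * ind (N ≤ |dot u x|) * (dot w x) ^ 2 * ind (|dot w x| ≤ t) ≤
      16 * YY w t (3 * N / 4) u x := by
  have hz := zz_nonneg w t x
  have e : (dot u x) ^ 2 * ind (N ≤ |dot u x|) * (dot w x) ^ 2 * ind (|dot w x| ≤ t)
      = zz w t x * ((dot u x) ^ 2 * ind (N ≤ |dot u x|)) := by unfold zz; ring
  rw [e]
  unfold YY
  have h : (dot u x) ^ 2 * ind (N ≤ |dot u x|) ≤ 16 * (max (|dot u x| - 3 * N / 4) 0) ^ 2 := by
    by_cases hc : N ≤ |dot u x|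
    · have h1 := le_max_left (|dot u x| - 3 * N / 4) 0
      have h2 : |dot u x| ≤ 4 * max (|dot u x| - 3 * N / 4) 0 := by linarith
      simp only [ind, hc, if_true, mul_one]
      rw [← sq_abs]
      nlinarith [mul_self_le_mul_self (abs_nonneg _) h2]
    · simp only [ind, hc, if_false, mul_zero]; positivity
  nlinarith [mul_le_mul_of_nonneg_left h hz]

theorem term_le0 {d : ℕ} (w : Fin d → ℝ) (t N : ℝ) (u x : Fin d → ℝ) :
    (dot u x) ^ 2 * ind (N ≤ |dot u x|) * (dot w x) ^ 2 * ind (|dot w x| ≤ t) ≤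
      YY w t 0 u x := by
  have hz := zz_nonneg w t x
  have e : (dot u x) ^ 2 * ind (N ≤ |dot u x|) * (dot w x) ^ 2 * ind (|dot w x| ≤ t)
      = zz w t x * ((dot u x) ^ 2 * ind (N ≤ |dot u x|)) := by unfold zz; ring
  rw [e, YY_zero]
  gcongr
  unfold ind; split_ifs <;> simp; positivity

theorem hom_bound {d : ℕ} (S : (Fin d → ℝ) → ℝ) (B : ℝ)
    (hom : ∀ (c : ℝ) u, S (c • u) = c ^ 2 * S u)
    (hB : ∀ u, nrm u = 1 → S u ≤ B) (u : Fin d → ℝ) : S u ≤ nrm u ^ 2 * B := by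
  have h0 : 0 ≤ nrm u := Real.sqrt_nonneg _
  rcases h0.eq_or_lt with h | h
  · have hu : u = (0 : ℝ) • u := by
      have h1 : ∑ j, (u j) ^ 2 = 0 := by
        have := h.symm
        unfold nrm at this
        rwa [Real.sqrt_eq_zero (Finset.sum_nonneg fun i _ => sq_nonneg _)] at this
      rw [Finset.sum_eq_zero_iff_of_nonneg (fun i _ => sq_nonneg _)] at h1
      ext j
      have := h1 j (Finset.mem_univ j)
      simpa using this
    rw [hu, hom, ← hu, ← h]; simp
  · have h1 : u = nrm u • ((nrm u)⁻¹ • u) := by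
      rw [smul_smul, mul_inv_cancel₀ h.ne', one_smul]
    have h2 := hB ((nrm u)⁻¹ • u) (by
      rw [nrm_smul _ (by positivity), inv_mul_cancel₀ h.ne'])
    calc S u = nrm u ^ 2 * S ((nrm u)⁻¹ • u) := by rw [← hom, ← h1]
      _ ≤ _ := by gcongr

theorem op_bound {d : ℕ} (S : (Fin d → ℝ) → ℝ) (m : ℝ) (w : Fin d → ℝ) (hw : nrm w = 1)
    (hom : ∀ (c : ℝ) u, S (c • u) = c ^ 2 * S u)
    (hnn : ∀ u, 0 ≤ S u)
    (hbd : ∃ R, ∀ u, nrm u = 1 → S u ≤ R)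
    (hpar : ∀ u v, S u ≤ 2 * S v + 2 * S (u - v))
    (s : Finset (Fin d → ℝ))
    (hnet : ∀ u : Fin d → ℝ, nrm u = 1 → ∃ v ∈ s, nrm (u - v) ≤ 1 / 2)
    (hm : ∀ v ∈ s, S v ≤ m) : ∀ u, nrm u = 1 → S u ≤ 4 * m := by
  set T : Set ℝ := S '' {u | nrm u = 1} with hT
  have hTb : BddAbove T := by
    obtain ⟨R, hR⟩ := hbd
    refine ⟨R, ?_⟩
    rintro _ ⟨u, hu, rfl⟩
    exact hR u hu
  have hle : ∀ u, nrm u = 1 → S u ≤ sSup T := fun u hu => le_csSup hTb ⟨u, hu, rfl⟩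
  have hB0 : 0 ≤ sSup T := (hnn w).trans (hle w hw)
  have key : sSup T ≤ 2 * m + sSup T / 2 := by
    refine csSup_le ⟨S w, w, hw, rfl⟩ ?_
    rintro _ ⟨u, hu, rfl⟩
    obtain ⟨v, hv, huv⟩ := hnet u hu
    have h1 := hpar u v
    have h2 := hom_bound S _ hom hle (u - v)
    have h3 := hm v hv
    have h4 : nrm (u - v) ^ 2 ≤ (1 / 2) ^ 2 := by
      gcongr; exact Real.sqrt_nonneg _
    have h5 : nrm (u - v) ^ 2 * sSup T ≤ (1 / 2) ^ 2 * sSup T := by gcongr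
    linarith
  intro u hu
  linarith [hle u hu]

theorem det_part {n d : ℕ} (w : Fin d → ℝ) (hw : nrm w = 1) (t N e : ℝ) (hN : 0 ≤ N) (he : 0 < e)
    (s1 s2 : Finset (Fin d → ℝ))
    (hs1 : ∀ u : Fin d → ℝ, nrm u = 1 → ∃ v ∈ s1, nrm (u - v) ≤ 1 / 2)
    (hs2 : ∀ u : Fin d → ℝ, nrm u = 1 → ∃ v ∈ s2, nrm (u - v) ≤ e)
    (x : Fin n → Fin d → ℝ)
    (h1 : ∀ v ∈ s1, ∑ i, YY w t 0 v (x i) ≤ n * (KK * Real.exp (-0 ^ 2 / 9) + 2 * KK * 1))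
    (h2 : ∀ v ∈ s2, ∑ i, YY w t (3 * N / 4) v (x i) ≤
      n * (KK * Real.exp (-(3 * N / 4) ^ 2 / 9) + 2 * KK * e))
    (u : Fin d → ℝ) (hu : nrm u = 1) :
    ∑ i, (dot u (x i)) ^ 2 * ind (N ≤ |dot u (x i)|) *
                  (dot w (x i)) ^ 2 * ind (|dot w (x i)| ≤ t) ≤
      n * (448 * KK * e + 448 * KK * Real.exp (-N ^ 2 / 16)) := by
  have hK := KK_ge
  have hom : ∀ (c : ℝ) u, ∑ i, YY w t 0 (c • u) (x i) = c ^ 2 * ∑ i, YY w t 0 u (x i) := by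
    intro c u
    simp only [YY_zero, dot_smul, Finset.mul_sum]
    refine Finset.sum_congr rfl fun i _ => ?_
    ring
  have hop : ∀ u, nrm u = 1 → ∑ i, YY w t 0 u (x i) ≤ n * (12 * KK) := by
    have := op_bound (fun u => ∑ i, YY w t 0 u (x i))
      (n * (KK * Real.exp (-0 ^ 2 / 9) + 2 * KK * 1)) w hw hom
      (fun u => Finset.sum_nonneg fun i _ => YY_nonneg _ _ _ _ _) ?_ ?_ s1 hs1 h1
    · intro u hu
      refine (this u hu).trans (le_of_eq ?_)
      simp; ring
    · refine ⟨∑ i, zz w t (x i) * ∑ j, (x i j) ^ 2, fun u hu => ?_⟩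
      refine Finset.sum_le_sum fun i _ => ?_
      rw [YY_zero]
      refine mul_le_mul_of_nonneg_left ?_ (zz_nonneg _ _ _)
      have hcs := Finset.sum_mul_sq_le_sq_mul_sq Finset.univ u (x i)
      have hu2 : ∑ j, (u j) ^ 2 = 1 := by
        unfold nrm at hu
        rwa [Real.sqrt_eq_one] at hu
      rw [hu2, one_mul] at hcs
      exact hcs
    · intro u v
      simp only [Finset.mul_sum, ← Finset.sum_add_distrib]
      exact Finset.sum_le_sum fun i _ => YY_par _ _ _ _ _ _
  have hexp := Real.exp_pos (-N ^ 2 / 16)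
  rcases le_or_gt e 1 with h | h
  · obtain ⟨v, hv, huv⟩ := hs2 u hu
    have a1 : ∑ i, (dot u (x i)) ^ 2 * ind (N ≤ |dot u (x i)|) *
                  (dot w (x i)) ^ 2 * ind (|dot w (x i)| ≤ t) ≤
        16 * ∑ i, YY w t (3 * N / 4) u (x i) := by
      rw [Finset.mul_sum]
      exact Finset.sum_le_sum fun i _ => term_le _ _ _ hN _ _
    have a2 : ∑ i, YY w t (3 * N / 4) u (x i) ≤
        2 * ∑ i, YY w t (3 * N / 4) v (x i) + 2 * ∑ i, YY w t 0 (u - v) (x i) := by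
      simp only [Finset.mul_sum, ← Finset.sum_add_distrib]
      exact Finset.sum_le_sum fun i _ => YY_par _ _ _ _ _ _
    have a3 := h2 v hv
    have a4 := hom_bound (fun u => ∑ i, YY w t 0 u (x i)) _ hom hop (u - v)
    have a5 : nrm (u - v) ^ 2 ≤ e := by
      have : nrm (u - v) ^ 2 ≤ e ^ 2 := by gcongr; exact Real.sqrt_nonneg _
      nlinarith
    have a6 : nrm (u - v) ^ 2 * (n * (12 * KK)) ≤ e * (n * (12 * KK)) := by gcongr
    have a7 : -(3 * N / 4) ^ 2 / 9 = -N ^ 2 / 16 := by ring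
    rw [a7] at a3
    have a8 : 0 ≤ n * (KK * Real.exp (-N ^ 2 / 16)) := by positivity
    nlinarith
  · have a1 : ∑ i, (dot u (x i)) ^ 2 * ind (N ≤ |dot u (x i)|) *
                  (dot w (x i)) ^ 2 * ind (|dot w (x i)| ≤ t) ≤ ∑ i, YY w t 0 u (x i) :=
      Finset.sum_le_sum fun i _ => term_le0 _ _ _ _ _
    refine a1.trans ((hop u hu).trans ?_)
    gcongr
    have : 0 ≤ 448 * KK * Real.exp (-N ^ 2 / 16) := by positivity
    nlinarith

theorem union_tail {n d : ℕ} (w : Fin d → ℝ) (t M e : ℝ) (hM : 0 ≤ M) (ht : 0 < t) (he : 0 < e)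
    (hw : nrm w = 1) (s : Finset (Fin d → ℝ)) (hs : ∀ v ∈ s, nrm v = 1) :
    (sample n d).real {x | ∃ v ∈ s,
      n * (KK * Real.exp (-M ^ 2 / 9) + 2 * KK * e) ≤ ∑ i, YY w t M v (x i)} ≤
      s.card * Real.exp (-(1 / 16) * min (n * e ^ 2) (n * e / t ^ 2)) := by
  have : {x : Fin n → Fin d → ℝ | ∃ v ∈ s,
      n * (KK * Real.exp (-M ^ 2 / 9) + 2 * KK * e) ≤ ∑ i, YY w t M v (x i)} =
      ⋃ v ∈ s, {x | n * (KK * Real.exp (-M ^ 2 / 9) + 2 * KK * e) ≤ ∑ i, YY w t M v (x i)} := by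
    ext x; simp
  rw [this]
  refine (measureReal_biUnion_finset_le s _).trans ?_
  rw [← nsmul_eq_mul (s.card), ← Finset.sum_const]
  refine Finset.sum_le_sum fun v hv => ?_
  exact ENNReal.toReal_le_of_le_ofReal (Real.exp_pos _).le (tail_YY w t M e hM ht he v hw (hs v hv))

/-- **Lemma C.3**: there exist absolute constants `C, c > 0` such that for any `2 ≤ N ≤ t`
and `ε > 0`, with probability at least
`1 - C e^{Cd - cn/t²} - C/(ε²n) - C(1 + CN²/ε)^d e^{-c min(nε², nε/t²)}`,
`sup_{u ∈ S^{d-1}} (1/n) Σ_i (u^⊤x_i)² 1_{|u^⊤x_i| ≥ N} (w*^⊤x_i)² 1_{|w*^⊤x_i| ≤ t}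
  ≤ Cε + CN³ e^{-N²/16}`. -/
theorem stmt13 :
    ∃ C > (0 : ℝ), ∃ c > (0 : ℝ),
      ∀ (n d : ℕ) (wstar : Fin d → ℝ) (t N ε : ℝ),
        nrm wstar = 1 → 2 ≤ N → N ≤ t → 0 < ε →
        1 - C * Real.exp (C * d - c * n / t ^ 2) - C / (ε ^ 2 * n) -
            C * (1 + C * N ^ 2 / ε) ^ d *
              Real.exp (-c * min (n * ε ^ 2) (n * ε / t ^ 2)) ≤
          (sample n d {x | ∀ u : Fin d → ℝ, nrm u = 1 →
              (1 / n) * ∑ i, (dot u (x i)) ^ 2 * ind (N ≤ |dot u (x i)|) *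
                  (dot wstar (x i)) ^ 2 * ind (|dot wstar (x i)| ≤ t) ≤
                C * ε + C * N ^ 3 * Real.exp (-N ^ 2 / 16)}).toReal := by
  have hK := KK_ge
  refine ⟨448 * KK, by positivity, 1 / 16, by norm_num, ?_⟩
  intro n d w t N ε hw hN hNt hε
  have ht : 0 < t := by linarith
  obtain ⟨s1, hs1, hc1, hn1⟩ := exists_net (d := d) (1 / 2) (by norm_num)
  obtain ⟨s2, hs2, hc2, hn2⟩ := exists_net (d := d) ε hε
  have hb1 := union_tail (n := n) w t 0 1 le_rfl ht one_pos hw s1 hs1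
  have hb2 := union_tail (n := n) w t (3 * N / 4) ε (by linarith) ht hε hw s2 hs2
  set B1 : Set (Fin n → Fin d → ℝ) := {x | ∃ v ∈ s1,
      n * (KK * Real.exp (-0 ^ 2 / 9) + 2 * KK * 1) ≤ ∑ i, YY w t 0 v (x i)} with hB1
  set B2 : Set (Fin n → Fin d → ℝ) := {x | ∃ v ∈ s2,
      n * (KK * Real.exp (-(3 * N / 4) ^ 2 / 9) + 2 * KK * ε) ≤
        ∑ i, YY w t (3 * N / 4) v (x i)} with hB2
  set T : Set (Fin n → Fin d → ℝ) := {x | ∀ u : Fin d → ℝ, nrm u = 1 →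
              (1 / n) * ∑ i, (dot u (x i)) ^ 2 * ind (N ≤ |dot u (x i)|) *
                  (dot w (x i)) ^ 2 * ind (|dot w (x i)| ≤ t) ≤
                448 * KK * ε + 448 * KK * N ^ 3 * Real.exp (-N ^ 2 / 16)} with hT
  have hexp := Real.exp_pos (-N ^ 2 / 16)
  have hcov : (Set.univ : Set (Fin n → Fin d → ℝ)) ⊆ T ∪ (B1 ∪ B2) := by
    intro x _
    by_cases hx1 : x ∈ B1
    · exact Or.inr (Or.inl hx1)
    by_cases hx2 : x ∈ B2
    · exact Or.inr (Or.inr hx2)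
    refine Or.inl ?_
    have h1 : ∀ v ∈ s1, ∑ i, YY w t 0 v (x i) ≤
        n * (KK * Real.exp (-0 ^ 2 / 9) + 2 * KK * 1) := by
      intro v hv
      by_contra hcon
      exact hx1 ⟨v, hv, (not_le.1 hcon).le⟩
    have h2 : ∀ v ∈ s2, ∑ i, YY w t (3 * N / 4) v (x i) ≤
        n * (KK * Real.exp (-(3 * N / 4) ^ 2 / 9) + 2 * KK * ε) := by
      intro v hv
      by_contra hcon
      exact hx2 ⟨v, hv, (not_le.1 hcon).le⟩
    intro u hu
    have h3 := det_part w hw t N ε (by linarith) hε s1 s2 hn1 hn2 x h1 h2 u hu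
    have hN3 : 1 ≤ N ^ 3 := one_le_pow₀ (by linarith)
    have h4 : 448 * KK * ε + 448 * KK * Real.exp (-N ^ 2 / 16) ≤
        448 * KK * ε + 448 * KK * N ^ 3 * Real.exp (-N ^ 2 / 16) := by
      have h5 : 448 * KK ≤ 448 * KK * N ^ 3 := le_mul_of_one_le_right (by positivity) hN3
      have h6 := mul_le_mul_of_nonneg_right h5 hexp.le
      linarith
    refine le_trans ?_ h4
    rcases Nat.eq_zero_or_pos n with hn | hn
    · subst hn
      simp only [Nat.cast_zero, div_zero, zero_mul]
      positivity
    · have hn' : (0 : ℝ) < n := by exact_mod_cast hn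
      rw [one_div, inv_mul_le_iff₀ hn']
      exact h3
  have hprob : 1 ≤ (sample n d).real T + ((sample n d).real B1 + (sample n d).real B2) := by
    calc (1 : ℝ) = (sample n d).real Set.univ := by simp
      _ ≤ (sample n d).real (T ∪ (B1 ∪ B2)) := measureReal_mono hcov
      _ ≤ (sample n d).real T + (sample n d).real (B1 ∪ B2) := measureReal_union_le _ _
      _ ≤ _ := by gcongr; exact measureReal_union_le _ _
  have hp1 : (sample n d).real B1 ≤
      448 * KK * Real.exp (448 * KK * d - 1 / 16 * n / t ^ 2) := by
    have hmin : min ((n : ℝ) * 1 ^ 2) (n * 1 / t ^ 2) = n / t ^ 2 := by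
      rw [min_eq_right] <;> simp
      apply div_le_self (by positivity)
      apply one_le_pow₀; linarith
    rw [hmin] at hb1
    have h5 : (s1.card : ℝ) ≤ Real.exp (448 * KK * d) := by
      calc (s1.card : ℝ) ≤ (1 + 2 / (1 / 2)) ^ d := hc1
        _ ≤ (Real.exp (448 * KK)) ^ d := by
          gcongr
          have := Real.add_one_le_exp (448 * KK)
          norm_num
          linarith
        _ = _ := by rw [← Real.exp_nat_mul]; ring_nf
    calc _ ≤ _ := hb1
      _ ≤ Real.exp (448 * KK * d) * Real.exp (-(1 / 16) * (n / t ^ 2)) := by gcongr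
      _ = Real.exp (448 * KK * d - 1 / 16 * n / t ^ 2) := by rw [← Real.exp_add]; ring_nf
      _ ≤ _ := le_mul_of_one_le_left (Real.exp_pos _).le (by linarith)
  have hp2 : (sample n d).real B2 ≤ 448 * KK * (1 + 448 * KK * N ^ 2 / ε) ^ d *
              Real.exp (-(1 / 16) * min (n * ε ^ 2) (n * ε / t ^ 2)) := by
    refine hb2.trans ?_
    gcongr
    calc (s2.card : ℝ) ≤ (1 + 2 / ε) ^ d := hc2
      _ ≤ (1 + 448 * KK * N ^ 2 / ε) ^ d := by
        gcongr
        nlinarith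
      _ ≤ _ := le_mul_of_one_le_left (by positivity) (by linarith)
  have hp3 : 0 ≤ 448 * KK / (ε ^ 2 * n) := by positivity
  change _ ≤ (sample n d).real T
  linarith
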